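/- arXiv:1610.02622 — 2 statements merged into one kernel-verified Lean document; each statement's English description precedes it below -/
import Mathlib

section
/- Let n ≥ 1 be an integer and let a, b be real numbers. Then the supremum, taken over all nonzero real symmetric n×n matrices A and all unit vectors v ∈ ℝⁿ, of the quantity ( ⟨(aA + b(tr A)·Iₙ)v, v⟩ / ‖A‖ )² equals (a+b)² + (n−1)b², and this supremum is attained by some symmetric matrix A and unit vector v. Here ⟨(aA + b(tr A)Iₙ)v, v⟩ = a·vᵀAv + b·tr A for a unit vector v. -/
open Matrix
/-- The Frobenius (Hilbert–Schmidt) norm of a real matrix: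
`‖A‖² = Σ_{i,j} A_{ij}²`. -/
noncomputable def frobeniusNorm {n : ℕ} (A : Matrix (Fin n) (Fin n) ℝ) : ℝ :=
  Real.sqrt (∑ i, ∑ j, (A i j) ^ 2)

/-- The matrix representing `A ↦ a vᵀAv + b tr A` with respect to the Frobenius inner product. -/
def rankOneAddScalar {n : ℕ} (a b : ℝ) (v : Fin n → ℝ) : Matrix (Fin n) (Fin n) ℝ :=
  a • vecMulVec v v + b • (1 : Matrix (Fin n) (Fin n) ℝ)

theorem rankOneAddScalar_isSymm {n : ℕ} (a b : ℝ) (v : Fin n → ℝ) :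
    (rankOneAddScalar a b v).IsSymm := by
  simp [Matrix.IsSymm, rankOneAddScalar, transpose_vecMulVec]

theorem sum_mul_rankOneAddScalar {n : ℕ} (a b : ℝ) (v : Fin n → ℝ)
    (A : Matrix (Fin n) (Fin n) ℝ) :
    ∑ i, ∑ j, A i j * rankOneAddScalar a b v i j =
      a * (v ⬝ᵥ A.mulVec v) + b * A.trace := by
  simp only [rankOneAddScalar, Matrix.add_apply, Matrix.smul_apply, vecMulVec_apply, smul_eq_mul,
    Matrix.one_apply, mul_add, Finset.sum_add_distrib, dotProduct, mulVec, trace, diag_apply,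
    Finset.mul_sum]
  congr 1
  · exact Finset.sum_congr rfl fun i _ => Finset.sum_congr rfl fun j _ => by ring
  · simp [mul_comm]

theorem sum_rankOneAddScalar_sq {n : ℕ} (a b : ℝ) {v : Fin n → ℝ} (hv : ∑ i, v i ^ 2 = 1) :
    ∑ i, ∑ j, rankOneAddScalar a b v i j ^ 2 = (a + b) ^ 2 + ((n : ℝ) - 1) * b ^ 2 := by
  have hvv : v ⬝ᵥ v = 1 := by simpa [dotProduct, sq] using hv
  simp only [sq (rankOneAddScalar a b v _ _), sum_mul_rankOneAddScalar]
  simp only [rankOneAddScalar, add_mulVec, smul_mulVec, vecMulVec_mulVec, one_mulVec,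
    dotProduct_add, dotProduct_smul, trace_add, trace_smul, trace_vecMulVec, trace_one, hvv,
    Fintype.card_fin, smul_eq_mul, MulOpposite.op_one, one_smul]
  ring

theorem sq_sum_mul_le_sum_sq_mul_sum_sq {n : ℕ} (A B : Matrix (Fin n) (Fin n) ℝ) :
    (∑ i, ∑ j, A i j * B i j) ^ 2 ≤ (∑ i, ∑ j, A i j ^ 2) * ∑ i, ∑ j, B i j ^ 2 := by
  simpa only [Fintype.sum_prod_type] using
    Finset.sum_mul_sq_le_sq_mul_sq Finset.univ
      (fun p : Fin n × Fin n => A p.1 p.2) (fun p => B p.1 p.2)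

theorem frobeniusNorm_sq {n : ℕ} (A : Matrix (Fin n) (Fin n) ℝ) :
    frobeniusNorm A ^ 2 = ∑ i, ∑ j, A i j ^ 2 :=
  Real.sq_sqrt (by positivity)

/-- Lemma 2.1: for real numbers `a, b`, the supremum over all nonzero real symmetric
`n × n` matrices `A` and all unit vectors `v` of
`(⟨(a A + b (tr A) Iₙ) v, v⟩ / ‖A‖)² = ((a vᵀAv + b tr A)/‖A‖)²`
equals `(a+b)² + (n−1) b²`, and it is attained. -/
theorem frobenius_quadratic_form_sup (n : ℕ) (hn : 1 ≤ n) (a b : ℝ) :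
    IsGreatest
      { q : ℝ | ∃ (A : Matrix (Fin n) (Fin n) ℝ) (v : Fin n → ℝ),
          A.IsSymm ∧ A ≠ 0 ∧ (∑ i, (v i) ^ 2) = 1 ∧
          q = ((a * (v ⬝ᵥ A.mulVec v) + b * A.trace) / frobeniusNorm A) ^ 2 }
      ((a + b) ^ 2 + ((n : ℝ) - 1) * b ^ 2) := by
  constructor
  · have : NeZero n := ⟨by omega⟩
    let v : Fin n → ℝ := Pi.single 0 1
    have hv : ∑ i, v i ^ 2 = 1 := by simp [v, Pi.single_apply]
    have hB := sum_rankOneAddScalar_sq a b hv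
    by_cases h : rankOneAddScalar a b v = 0
    · refine ⟨1, v, isSymm_one, one_ne_zero, hv, ?_⟩
      rw [← sum_mul_rankOneAddScalar, ← hB]
      simp [h]
    · refine ⟨_, v, rankOneAddScalar_isSymm a b v, h, hv, ?_⟩
      rw [← sum_mul_rankOneAddScalar, div_pow, frobeniusNorm_sq]
      simp only [← sq (rankOneAddScalar a b v _ _), hB]
      rw [sq ((a + b) ^ 2 + _), mul_self_div_self]
  · rintro _ ⟨A, v, -, -, hv, rfl⟩
    rw [← sum_mul_rankOneAddScalar, div_pow, frobeniusNorm_sq, ← sum_rankOneAddScalar_sq a b hv]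
    refine div_le_of_le_mul₀ (by positivity) (by positivity) ?_
    rw [mul_comm]
    exact sq_sum_mul_le_sum_sq_mul_sum_sq A _
end

section
/- Let n ≥ 1 be an integer and M > 0. Then there exists a constant C > 0 depending only on n and M with the following property. For every x₀ ∈ ℝⁿ, R, T > 0, t₀ ∈ ℝ, and every smooth positive solution u of the heat equation u_t = Δu on Q_{R,T} satisfying u ≤ M on Q_{R,T}, one has at every point of Q_{R/2,T/2}: |∇u|/√u ≤ C·(1/R + 1/√T). -/
open Metric Set Filter

/-- The Laplacian (in the spatial variable) of a function on `ℝⁿ`, computed as the sum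
of the second partial derivatives along the standard coordinate directions. -/
noncomputable def lap {n : ℕ} (f : EuclideanSpace ℝ (Fin n) → ℝ)
    (x : EuclideanSpace ℝ (Fin n)) : ℝ :=
  ∑ i : Fin n,
    fderiv ℝ (fun y => fderiv ℝ f y (EuclideanSpace.single i 1)) x
      (EuclideanSpace.single i 1)

open scoped Topology ContDiff

section DirectionalDerivatives

variable {V : Type*} [NormedAddCommGroup V] [NormedSpace ℝ V]

/-- The derivative of `f` in the direction `w`, as a function of the base point. -/
noncomputable def dirDeriv (w : V) (f : V → ℝ) (p : V) : ℝ := fderiv ℝ f p w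

variable {f g : V → ℝ} {p : V} {U : Set V}

lemma dirDeriv_mul (w : V) (hf : DifferentiableAt ℝ f p) (hg : DifferentiableAt ℝ g p) :
    dirDeriv w (fun q => f q * g q) p = dirDeriv w f p * g p + f p * dirDeriv w g p := by
  simp only [dirDeriv, fderiv_fun_mul hf hg, add_apply, smul_apply, smul_eq_mul]
  ring

lemma dirDeriv_add (w : V) (hf : DifferentiableAt ℝ f p) (hg : DifferentiableAt ℝ g p) :
    dirDeriv w (fun q => f q + g q) p = dirDeriv w f p + dirDeriv w g p := by
  simp [dirDeriv, fderiv_fun_add hf hg]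

lemma dirDeriv_sub (w : V) (hf : DifferentiableAt ℝ f p) (hg : DifferentiableAt ℝ g p) :
    dirDeriv w (fun q => f q - g q) p = dirDeriv w f p - dirDeriv w g p := by
  simp [dirDeriv, fderiv_fun_sub hf hg]

lemma dirDeriv_const_mul (w : V) (c : ℝ) (hf : DifferentiableAt ℝ f p) :
    dirDeriv w (fun q => c * f q) p = c * dirDeriv w f p := by
  simp [dirDeriv, fderiv_const_mul hf]

lemma dirDeriv_sum {ι : Type*} {s : Finset ι} {F : ι → V → ℝ} (w : V)
    (hF : ∀ i ∈ s, DifferentiableAt ℝ (F i) p) :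
    dirDeriv w (fun q => ∑ i ∈ s, F i q) p = ∑ i ∈ s, dirDeriv w (F i) p := by
  simp [dirDeriv, fderiv_fun_sum hF]

lemma dirDeriv_sq (w : V) (hf : DifferentiableAt ℝ f p) :
    dirDeriv w (fun q => f q ^ 2) p = 2 * (f p * dirDeriv w f p) := by
  simp only [pow_two, dirDeriv_mul w hf hf]
  ring

lemma dirDeriv_congr (w : V) (hU : IsOpen U) (h : EqOn f g U) (hp : p ∈ U) :
    dirDeriv w f p = dirDeriv w g p := by
  unfold dirDeriv
  rw [(h.eventuallyEq_of_mem (hU.mem_nhds hp)).fderiv_eq]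

lemma ContDiffOn.dirDeriv (w : V) (hU : IsOpen U) (hf : ContDiffOn ℝ ∞ f U) :
    ContDiffOn ℝ ∞ (dirDeriv w f) U :=
  (hf.fderiv_of_isOpen hU (by simp)).clm_apply contDiffOn_const

lemma ContDiffOn.differentiableAt_of_isOpen (hU : IsOpen U) (hf : ContDiffOn ℝ ∞ f U)
    (hp : p ∈ U) : DifferentiableAt ℝ f p :=
  (hf.contDiffAt (hU.mem_nhds hp)).differentiableAt (by simp)

lemma dirDeriv_comm (v w : V) (hU : IsOpen U) (hf : ContDiffOn ℝ ∞ f U) (hp : p ∈ U) :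
    dirDeriv v (dirDeriv w f) p = dirDeriv w (dirDeriv v f) p := by
  have hd : DifferentiableAt ℝ (fderiv ℝ f) p :=
    ((hf.fderiv_of_isOpen hU (m := ∞) (by simp)).contDiffAt (hU.mem_nhds hp)).differentiableAt
      (by simp)
  have hs : IsSymmSndFDerivAt ℝ f p :=
    (hf.contDiffAt (hU.mem_nhds hp)).isSymmSndFDerivAt (by
      simpa using WithTop.coe_le_coe.2 (le_top : (2 : ℕ∞) ≤ ⊤))
  have key (a b : V) : _root_.dirDeriv a (_root_.dirDeriv b f) p = fderiv ℝ (fderiv ℝ f) p a b := by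
    unfold _root_.dirDeriv
    rw [fderiv_clm_apply hd (differentiableAt_const b)]
    simp
  rw [key, key, hs.eq]

lemma hasDerivAt_line (w : V) {h : ℝ} (hf : DifferentiableAt ℝ f (p + h • w)) :
    HasDerivAt (fun s : ℝ => f (p + s • w)) (dirDeriv w f (p + h • w)) h := by
  have h1 : HasDerivAt (fun s : ℝ => p + s • w) w h := by
    simpa using ((hasDerivAt_id h).smul_const w).const_add p
  exact hf.hasFDerivAt.comp_hasDerivAt h h1

lemma deriv_deriv_nonpos_of_isLocalMax {φ : ℝ → ℝ} {a : ℝ} (hφ : ContinuousAt φ a)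
    (h : IsLocalMax φ a) : deriv (deriv φ) a ≤ 0 := by
  by_contra! hpos
  have hmin := isLocalMin_of_deriv_deriv_pos hpos h.deriv_eq_zero hφ
  have hconst : φ =ᶠ[𝓝 a] fun _ => φ a := by
    filter_upwards [h, hmin] with x h1 h2 using le_antisymm h1 h2
  have := hconst.deriv.deriv_eq
  simp at this
  linarith

lemma dirDeriv_eq_zero_of_isLocalMax_line (w : V) (hf : DifferentiableAt ℝ f p)
    (h : IsLocalMax (fun s : ℝ => f (p + s • w)) 0) : dirDeriv w f p = 0 := by
  have := hasDerivAt_line (f := f) (p := p) w (h := 0) (by simpa using hf)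
  simpa using h.hasDerivAt_eq_zero this

lemma dirDeriv_dirDeriv_nonpos_of_isLocalMax_line (w : V) (hU : IsOpen U)
    (hf : ContDiffOn ℝ ∞ f U) (hp : p ∈ U) (h : IsLocalMax (fun s : ℝ => f (p + s • w)) 0) :
    dirDeriv w (dirDeriv w f) p ≤ 0 := by
  have hline : ∀ᶠ s : ℝ in 𝓝 0, p + s • w ∈ U := by
    have hc : ContinuousAt (fun s : ℝ => p + s • w) 0 := by fun_prop
    exact hc.eventually_mem (by simpa using hU.mem_nhds hp)
  have h1 : deriv (fun s : ℝ => f (p + s • w)) =ᶠ[𝓝 0] fun s => dirDeriv w f (p + s • w) := by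
    filter_upwards [hline] with s hs
    exact (hasDerivAt_line w (hf.differentiableAt_of_isOpen hU hs)).deriv
  have h2 : HasDerivAt (fun s : ℝ => dirDeriv w f (p + s • w))
      (dirDeriv w (dirDeriv w f) (p + (0 : ℝ) • w)) 0 :=
    hasDerivAt_line w ((hf.dirDeriv w hU).differentiableAt_of_isOpen hU (by simpa using hp))
  have h3 := deriv_deriv_nonpos_of_isLocalMax
    (hasDerivAt_line w (hf.differentiableAt_of_isOpen hU (by simpa using hp))).continuousAt h
  rw [h1.deriv_eq, h2.deriv] at h3
  simpa using h3

end DirectionalDerivatives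
section MaximumPoint

/-- The algebra at a maximum point of `η * |∇u|² / u`: `S` stands for `|∇²u|²`, `P` for `|∇u|²`,
`Γ` for `|∇η|²`, `X` for `∇u · ∇η`, and `q` for `∇²u ∇u`. -/
lemma max_point_algebra {η P u m S Γ X Q Y A B b : ℝ} (hη : 0 < η) (hu : 0 < u) (hP : 0 < P)
    (hm : m * u = η * P) (hΓ : Γ ≤ A * η) (hb : b ≤ B) (hX : X ^ 2 ≤ P * Γ) (hQS : Q ≤ S * P)
    (hQ : 4 * η ^ 2 * Q = m ^ 2 * P - 2 * m * P * X + P ^ 2 * Γ)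
    (hY : 2 * η * Y = m * X - P * Γ)
    (hmain : 0 ≤ P * b - 4 * Y - 2 * η * S) :
    m ≤ 4 * u * (5 / 2 * A + B) := by
  obtain rfl : m = η * P / u := by field_simp; linarith
  -- multiply the main inequality by `2 η`
  have h1 : 0 ≤ 2 * η * (P * B) - 4 * ((η * P / u) * X - P * Γ) - 4 * η ^ 2 * S := by
    rw [← hY]
    have : P * b ≤ P * B := by gcongr
    nlinarith [mul_nonneg hη.le hmain, mul_le_mul_of_nonneg_left this hη.le]
  have h2 : P * (4 * η ^ 2 * S) ≥ P * ((η * P / u) ^ 2 - 2 * (η * P / u) * X + P * Γ) := by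
    nlinarith [mul_le_mul_of_nonneg_left hQS (by positivity : 0 ≤ 4 * η ^ 2)]
  have h3 := le_of_mul_le_mul_left h2 hP
  have h4 : (η * P / u) ^ 2 + 2 * (η * P / u) * X ≤ 3 * (P * Γ) + 2 * η * (P * B) := by linarith
  have h5 : -(2 * (η * P / u) * X) ≤ (η * P / u) ^ 2 / 2 + 2 * (P * Γ) := by
    nlinarith [sq_nonneg (η * P / u + 2 * X)]
  have h6 : P * Γ ≤ P * (A * η) := by gcongr
  have h7 : (η * P / u) * (η * P / u) ≤ (η * P / u) * (4 * u * (5 / 2 * A + B)) := by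
    have : (η * P / u) * (4 * u * (5 / 2 * A + B)) = 4 * η * P * (5 / 2 * A + B) := by
      field_simp
    rw [this]
    nlinarith
  exact le_of_mul_le_mul_left h7 (by positivity)

variable {V ι : Type*} [NormedAddCommGroup V] [NormedSpace ℝ V] [Fintype ι]

/-- The squared length of the gradient in the directions `e i`. -/
noncomputable def gradSq (e : ι → V) (u : V → ℝ) (p : V) : ℝ := ∑ j, dirDeriv (e j) u p ^ 2

variable {e : ι → V} {τ : V} {U : Set V} {u η : V → ℝ} {p : V}

lemma ContDiffOn.gradSq (e : ι → V) (hU : IsOpen U) (hu : ContDiffOn ℝ ∞ u U) :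
    ContDiffOn ℝ ∞ (gradSq e u) U :=
  ContDiffOn.sum fun j _ => (hu.dirDeriv (e j) hU).pow 2

lemma dirDeriv_gradSq (w : V) (hU : IsOpen U) (hu : ContDiffOn ℝ ∞ u U) (hp : p ∈ U) :
    dirDeriv w (gradSq e u) p =
      2 * ∑ j, dirDeriv (e j) u p * dirDeriv w (dirDeriv (e j) u) p := by
  have hd (j : ι) : DifferentiableAt ℝ (dirDeriv (e j) u) p :=
    (hu.dirDeriv (e j) hU).differentiableAt_of_isOpen hU hp
  unfold gradSq
  rw [dirDeriv_sum w (fun j _ => (hd j).fun_pow 2), Finset.mul_sum]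
  exact Finset.sum_congr rfl fun j _ => dirDeriv_sq w (hd j)

lemma dirDeriv_dirDeriv_gradSq (w : V) (hU : IsOpen U) (hu : ContDiffOn ℝ ∞ u U) (hp : p ∈ U) :
    dirDeriv w (dirDeriv w (gradSq e u)) p =
      2 * ∑ j, (dirDeriv w (dirDeriv (e j) u) p ^ 2 +
        dirDeriv (e j) u p * dirDeriv w (dirDeriv w (dirDeriv (e j) u)) p) := by
  have h1 (j : ι) : DifferentiableAt ℝ (dirDeriv (e j) u) p :=
    (hu.dirDeriv (e j) hU).differentiableAt_of_isOpen hU hp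
  have h2 (j : ι) : DifferentiableAt ℝ (dirDeriv w (dirDeriv (e j) u)) p :=
    ((hu.dirDeriv (e j) hU).dirDeriv w hU).differentiableAt_of_isOpen hU hp
  rw [dirDeriv_congr w hU (fun q hq => dirDeriv_gradSq w hU hu hq) hp,
    dirDeriv_const_mul w _ (DifferentiableAt.fun_sum fun j _ => (h1 j).fun_mul (h2 j)),
    dirDeriv_sum w (fun j _ => (h1 j).fun_mul (h2 j))]
  congr 1
  refine Finset.sum_congr rfl fun j _ => ?_
  rw [dirDeriv_mul w (h1 j) (h2 j)]
  ring

/-- The Bochner formula for the heat equation in the directions `e i`. -/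
lemma heat_gradSq (hU : IsOpen U) (hu : ContDiffOn ℝ ∞ u U)
    (heat : ∀ q ∈ U, dirDeriv τ u q = ∑ i, dirDeriv (e i) (dirDeriv (e i) u) q) (hp : p ∈ U) :
    dirDeriv τ (gradSq e u) p - ∑ i, dirDeriv (e i) (dirDeriv (e i) (gradSq e u)) p =
      -2 * ∑ i, ∑ j, dirDeriv (e i) (dirDeriv (e j) u) p ^ 2 := by
  have hd (i : ι) : ContDiffOn ℝ ∞ (dirDeriv (e i) u) U := hu.dirDeriv (e i) hU
  have third (j : ι) : dirDeriv τ (dirDeriv (e j) u) p =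
      ∑ i, dirDeriv (e i) (dirDeriv (e i) (dirDeriv (e j) u)) p := by
    rw [dirDeriv_comm τ (e j) hU hu hp, dirDeriv_congr (e j) hU heat hp,
      dirDeriv_sum (e j) fun i _ =>
        ((hd i).dirDeriv (e i) hU).differentiableAt_of_isOpen hU hp]
    refine Finset.sum_congr rfl fun i _ => ?_
    rw [dirDeriv_comm (e j) (e i) hU (hd i) hp]
    exact dirDeriv_congr (e i) hU (fun q hq => dirDeriv_comm (e j) (e i) hU hu hq) hp
  rw [dirDeriv_gradSq τ hU hu hp]
  simp_rw [dirDeriv_dirDeriv_gradSq _ hU hu hp, third, Finset.sum_add_distrib, mul_add,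
    Finset.sum_add_distrib, ← Finset.mul_sum]
  have hcomm : ∑ j, dirDeriv (e j) u p * ∑ i, dirDeriv (e i) (dirDeriv (e i) (dirDeriv (e j) u)) p =
      ∑ i, ∑ j, dirDeriv (e j) u p * dirDeriv (e i) (dirDeriv (e i) (dirDeriv (e j) u)) p := by
    simp_rw [Finset.mul_sum]
    exact Finset.sum_comm
  rw [hcomm]
  ring

/-- A Bernstein-type estimate at a point where `η |∇u|² - m u` vanishes and is maximal in the
spatial directions `e i` and in backward time. -/
theorem le_of_max_point (hU : IsOpen U) (hu : ContDiffOn ℝ ∞ u U) (hη : ContDiffOn ℝ ∞ η U)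
    (heat : ∀ q ∈ U, dirDeriv τ u q = ∑ i, dirDeriv (e i) (dirDeriv (e i) u) q)
    (hp : p ∈ U) (hup : 0 < u p) (hηp : 0 < η p) {m A B : ℝ} (hm0 : 0 < m)
    (hm : m * u p = η p * gradSq e u p)
    (hx : ∀ i, IsLocalMax
      (fun s : ℝ => η (p + s • e i) * gradSq e u (p + s • e i) - m * u (p + s • e i)) 0)
    (ht : 0 ≤ dirDeriv τ (fun q => η q * gradSq e u q - m * u q) p)
    (hA : gradSq e η p ≤ A * η p)
    (hB : dirDeriv τ η p - ∑ i, dirDeriv (e i) (dirDeriv (e i) η) p ≤ B) :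
    m ≤ 4 * u p * (5 / 2 * A + B) := by
  have hP := hu.gradSq e hU
  have dd {f : V → ℝ} (hf : ContDiffOn ℝ ∞ f U) {q : V} (hq : q ∈ U) : DifferentiableAt ℝ f q :=
    hf.differentiableAt_of_isOpen hU hq
  have hPp : 0 < gradSq e u p := by
    have : 0 < η p * gradSq e u p := hm ▸ mul_pos hm0 hup
    exact pos_of_mul_pos_right this hηp.le
  have hG : ContDiffOn ℝ ∞ (fun q => η q * gradSq e u q - m * u q) U :=
    (hη.mul hP).sub (contDiffOn_const.mul hu)
  have first (w : V) {q : V} (hq : q ∈ U) :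
      dirDeriv w (fun q => η q * gradSq e u q - m * u q) q =
        dirDeriv w η q * gradSq e u q + η q * dirDeriv w (gradSq e u) q - m * dirDeriv w u q := by
    rw [dirDeriv_sub w ((dd hη hq).fun_mul (dd hP hq)) ((dd hu hq).const_mul m),
      dirDeriv_mul w (dd hη hq) (dd hP hq), dirDeriv_const_mul w m (dd hu hq)]
  have second (w : V) : dirDeriv w (dirDeriv w (fun q => η q * gradSq e u q - m * u q)) p =
      dirDeriv w (dirDeriv w η) p * gradSq e u p + 2 * (dirDeriv w η p * dirDeriv w (gradSq e u) p)
        + η p * dirDeriv w (dirDeriv w (gradSq e u)) p - m * dirDeriv w (dirDeriv w u) p := by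
    have h1 := dd (hη.dirDeriv w hU) hp
    have h2 := dd (hP.dirDeriv w hU) hp
    have h3 := dd (hu.dirDeriv w hU) hp
    rw [dirDeriv_congr w hU (fun q hq => first w hq) hp,
      dirDeriv_sub w ((h1.fun_mul (dd hP hp)).fun_add ((dd hη hp).fun_mul h2)) (h3.const_mul m),
      dirDeriv_add w (h1.fun_mul (dd hP hp)) ((dd hη hp).fun_mul h2),
      dirDeriv_mul w h1 (dd hP hp), dirDeriv_mul w (dd hη hp) h2, dirDeriv_const_mul w m h3]
    ring
  set q : ι → ℝ := fun i => ∑ j, dirDeriv (e j) u p * dirDeriv (e i) (dirDeriv (e j) u) p with hq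
  have hgradP (i : ι) : dirDeriv (e i) (gradSq e u) p = 2 * q i := dirDeriv_gradSq _ hU hu hp
  have hgrad (i : ι) : 2 * η p * q i = m * dirDeriv (e i) u p - gradSq e u p * dirDeriv (e i) η p := by
    have := dirDeriv_eq_zero_of_isLocalMax_line (e i) (dd hG hp) (hx i)
    rw [first _ hp, hgradP] at this
    linarith
  have hlap : ∑ i, dirDeriv (e i) (dirDeriv (e i) (fun q => η q * gradSq e u q - m * u q)) p ≤ 0 :=
    Finset.sum_nonpos fun i _ => dirDeriv_dirDeriv_nonpos_of_isLocalMax_line (e i) hU hG hp (hx i)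
  refine max_point_algebra (S := ∑ i, ∑ j, dirDeriv (e i) (dirDeriv (e j) u) p ^ 2)
    (X := ∑ i, dirDeriv (e i) u p * dirDeriv (e i) η p) (Q := ∑ i, q i ^ 2)
    (Y := ∑ i, dirDeriv (e i) η p * q i) hηp hup hPp hm hA hB
    (Finset.sum_mul_sq_le_sq_mul_sq _ _ _) ?_ ?_ ?_ ?_
  · rw [Finset.sum_mul]
    refine Finset.sum_le_sum fun i _ => ?_
    rw [mul_comm]
    exact Finset.sum_mul_sq_le_sq_mul_sq _ _ _
  · have h1 (i : ι) : 4 * η p ^ 2 * q i ^ 2 = m ^ 2 * dirDeriv (e i) u p ^ 2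
        - 2 * m * gradSq e u p * (dirDeriv (e i) u p * dirDeriv (e i) η p)
        + gradSq e u p ^ 2 * dirDeriv (e i) η p ^ 2 := by
      calc 4 * η p ^ 2 * q i ^ 2 = (2 * η p * q i) ^ 2 := by ring
        _ = _ := by rw [hgrad]; ring
    rw [Finset.mul_sum, Finset.sum_congr rfl fun i _ => h1 i, Finset.sum_add_distrib,
      Finset.sum_sub_distrib, ← Finset.mul_sum, ← Finset.mul_sum, ← Finset.mul_sum]
    rfl
  · have h1 (i : ι) : 2 * η p * (dirDeriv (e i) η p * q i) =
        m * (dirDeriv (e i) u p * dirDeriv (e i) η p)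
          - gradSq e u p * dirDeriv (e i) η p ^ 2 := by
      linear_combination dirDeriv (e i) η p * hgrad i
    rw [Finset.mul_sum, Finset.sum_congr rfl fun i _ => h1 i,
      Finset.sum_sub_distrib, ← Finset.mul_sum, ← Finset.mul_sum]
    rfl
  · have hboch := heat_gradSq hU hu heat hp
    simp only [second, hgradP, Finset.sum_add_distrib, Finset.sum_sub_distrib, ← Finset.mul_sum,
      ← Finset.sum_mul, ← heat p hp] at hlap
    rw [first τ hp] at ht
    have hY : ∑ i, dirDeriv (e i) η p * (2 * q i) = 2 * ∑ i, dirDeriv (e i) η p * q i := by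
      rw [Finset.mul_sum]
      exact Finset.sum_congr rfl fun i _ => by ring
    rw [hY] at hlap
    linear_combination ht + hlap + η p * hboch

end MaximumPoint
section InteriorEstimate

variable {n : ℕ}

/-- The `i`-th spatial coordinate direction in `ℝⁿ × ℝ`. -/
noncomputable def spaceDir (i : Fin n) : EuclideanSpace ℝ (Fin n) × ℝ :=
  (EuclideanSpace.single i 1, 0)

/-- The time direction in `ℝⁿ × ℝ`. -/
noncomputable def timeDir (n : ℕ) : EuclideanSpace ℝ (Fin n) × ℝ := (0, 1)

/-- A cutoff function vanishing on the lateral boundary and at the bottom of the cylinder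
`B(x₀, ρ) × [a, ∞)`. -/
noncomputable def cutoff (x₀ : EuclideanSpace ℝ (Fin n)) (ρ a : ℝ)
    (p : EuclideanSpace ℝ (Fin n) × ℝ) : ℝ :=
  (ρ ^ 2 - ‖p.1 - x₀‖ ^ 2) ^ 2 * (p.2 - a)

variable {x₀ : EuclideanSpace ℝ (Fin n)} {ρ a : ℝ}

lemma contDiff_cutoff : ContDiff ℝ ∞ (cutoff x₀ ρ a) := by
  have : ContDiff ℝ ∞ fun p : EuclideanSpace ℝ (Fin n) × ℝ => ‖p.1 - x₀‖ ^ 2 :=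
    (contDiff_fst.sub contDiff_const).norm_sq ℝ
  exact ((contDiff_const.sub this).pow 2).mul (contDiff_snd.sub contDiff_const)

lemma hasFDerivAt_dist_sq (p : EuclideanSpace ℝ (Fin n) × ℝ) :
    HasFDerivAt (fun p : EuclideanSpace ℝ (Fin n) × ℝ => ρ ^ 2 - ‖p.1 - x₀‖ ^ 2)
      (-(2 • (innerSL ℝ (p.1 - x₀)) ∘L ContinuousLinearMap.fst ℝ _ ℝ)) p := by
  have h : HasFDerivAt (fun p : EuclideanSpace ℝ (Fin n) × ℝ => p.1 - x₀)
      (ContinuousLinearMap.fst ℝ _ ℝ) p := hasFDerivAt_fst.sub_const x₀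
  exact h.norm_sq.const_sub _

lemma dirDeriv_cutoff (w p : EuclideanSpace ℝ (Fin n) × ℝ) :
    dirDeriv w (cutoff x₀ ρ a) p =
      -4 * (ρ ^ 2 - ‖p.1 - x₀‖ ^ 2) * (p.2 - a) * inner ℝ (p.1 - x₀) w.1 +
        (ρ ^ 2 - ‖p.1 - x₀‖ ^ 2) ^ 2 * w.2 := by
  have h := (((hasFDerivAt_dist_sq (x₀ := x₀) (ρ := ρ) p).pow 2).mul
    ((hasFDerivAt_snd (𝕜 := ℝ) (p := p)).sub_const a)).fderiv
  unfold dirDeriv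
  change fderiv ℝ (cutoff x₀ ρ a) p = _ at h
  rw [h]
  simp [inner_sub_left]
  ring

lemma dirDeriv_spaceDir_cutoff (i : Fin n) (p : EuclideanSpace ℝ (Fin n) × ℝ) :
    dirDeriv (spaceDir i) (cutoff x₀ ρ a) p =
      (ρ ^ 2 - ‖p.1 - x₀‖ ^ 2) * (-4 * (p.2 - a) * (p.1 - x₀) i) := by
  rw [dirDeriv_cutoff]
  simp [spaceDir, EuclideanSpace.inner_single_right]
  ring

lemma dirDeriv_timeDir_cutoff (p : EuclideanSpace ℝ (Fin n) × ℝ) :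
    dirDeriv (timeDir n) (cutoff x₀ ρ a) p = (ρ ^ 2 - ‖p.1 - x₀‖ ^ 2) ^ 2 := by
  rw [dirDeriv_cutoff]
  simp [timeDir]

lemma dirDeriv_dirDeriv_spaceDir_cutoff (i : Fin n) (p : EuclideanSpace ℝ (Fin n) × ℝ) :
    dirDeriv (spaceDir i) (dirDeriv (spaceDir i) (cutoff x₀ ρ a)) p =
      (p.2 - a) * (8 * (p.1 - x₀) i ^ 2 - 4 * (ρ ^ 2 - ‖p.1 - x₀‖ ^ 2)) := by
  rw [funext (dirDeriv_spaceDir_cutoff (x₀ := x₀) (ρ := ρ) (a := a) i)]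
  have h1 : HasFDerivAt (fun p : EuclideanSpace ℝ (Fin n) × ℝ => (p.1 - x₀) i)
      ((EuclideanSpace.proj i).comp (ContinuousLinearMap.fst ℝ _ ℝ)) p :=
    (EuclideanSpace.proj (𝕜 := ℝ) i).hasFDerivAt.comp p (hasFDerivAt_fst.sub_const x₀)
  have h := ((hasFDerivAt_dist_sq (x₀ := x₀) (ρ := ρ) p).mul
    ((((hasFDerivAt_snd (𝕜 := ℝ) (p := p)).sub_const a).const_mul (-4)).mul h1)).fderiv
  unfold dirDeriv
  refine (congrArg (fun L : EuclideanSpace ℝ (Fin n) × ℝ →L[ℝ] ℝ => L (spaceDir i)) h).trans ?_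
  simp [spaceDir, EuclideanSpace.inner_single_right]
  ring

lemma gradSq_cutoff (p : EuclideanSpace ℝ (Fin n) × ℝ) :
    gradSq spaceDir (cutoff x₀ ρ a) p =
      16 * ‖p.1 - x₀‖ ^ 2 * (p.2 - a) * cutoff x₀ ρ a p := by
  simp only [gradSq, dirDeriv_spaceDir_cutoff, mul_pow, ← Finset.mul_sum,
    ← EuclideanSpace.real_norm_sq_eq, cutoff]
  ring

lemma heat_cutoff (p : EuclideanSpace ℝ (Fin n) × ℝ) :
    dirDeriv (timeDir n) (cutoff x₀ ρ a) p
      - ∑ i, dirDeriv (spaceDir i) (dirDeriv (spaceDir i) (cutoff x₀ ρ a)) p =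
      (ρ ^ 2 - ‖p.1 - x₀‖ ^ 2) ^ 2
        + (p.2 - a) * (4 * n * (ρ ^ 2 - ‖p.1 - x₀‖ ^ 2) - 8 * ‖p.1 - x₀‖ ^ 2) := by
  simp only [dirDeriv_dirDeriv_spaceDir_cutoff, dirDeriv_timeDir_cutoff, ← Finset.mul_sum,
    Finset.sum_sub_distrib, Finset.sum_const, Finset.card_univ, Fintype.card_fin, nsmul_eq_mul,
    EuclideanSpace.real_norm_sq_eq (p.1 - x₀)]
  ring

/-- The localized gradient estimate for solutions smooth in a neighbourhood of the cylinder. -/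
theorem cutoff_mul_gradSq_le {b M : ℝ} {U : Set (EuclideanSpace ℝ (Fin n) × ℝ)}
    {u : EuclideanSpace ℝ (Fin n) × ℝ → ℝ} (hM : 0 < M) (hρ : 0 < ρ) (hab : a ≤ b)
    (hU : IsOpen U) (hKU : closedBall x₀ ρ ×ˢ Icc a b ⊆ U) (hu : ContDiffOn ℝ ∞ u U)
    (heat : ∀ q ∈ U, dirDeriv (timeDir n) u q =
      ∑ i, dirDeriv (spaceDir i) (dirDeriv (spaceDir i) u) q)
    (hpos : ∀ p ∈ closedBall x₀ ρ ×ˢ Icc a b, 0 < u p)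
    (hle : ∀ p ∈ closedBall x₀ ρ ×ˢ Icc a b, u p ≤ M)
    {p : EuclideanSpace ℝ (Fin n) × ℝ} (hp : p ∈ closedBall x₀ ρ ×ˢ Icc a b) :
    cutoff x₀ ρ a p * gradSq spaceDir u p ≤
      4 * M * (40 * ρ ^ 2 * (b - a) + (ρ ^ 4 + 4 * n * ρ ^ 2 * (b - a))) * u p := by
  set K := closedBall x₀ ρ ×ˢ Icc a b with hK
  have hba : 0 ≤ b - a := by linarith
  have hP := hu.gradSq spaceDir hU
  have hη : ContDiffOn ℝ ∞ (cutoff x₀ ρ a) U := contDiff_cutoff.contDiffOn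
  have hcont : ContinuousOn (fun q => cutoff x₀ ρ a q * gradSq spaceDir u q / u q) K :=
    ((hη.continuousOn.mono hKU).mul (hP.continuousOn.mono hKU)).div (hu.continuousOn.mono hKU)
      fun q hq => (hpos q hq).ne'
  have hKc : IsCompact K := (isCompact_closedBall x₀ ρ).prod isCompact_Icc
  obtain ⟨p₀, hp₀, hmax⟩ := hKc.exists_isMaxOn ⟨p, hp⟩ hcont
  set m := cutoff x₀ ρ a p₀ * gradSq spaceDir u p₀ / u p₀ with hm
  have hmul : m * u p₀ = cutoff x₀ ρ a p₀ * gradSq spaceDir u p₀ :=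
    div_mul_cancel₀ _ (hpos p₀ hp₀).ne'
  have hmle : ∀ q ∈ K, cutoff x₀ ρ a q * gradSq spaceDir u q ≤ m * u q := fun q hq =>
    (div_le_iff₀ (hpos q hq)).1 (hmax hq)
  suffices m ≤ 4 * M * (40 * ρ ^ 2 * (b - a) + (ρ ^ 4 + 4 * n * ρ ^ 2 * (b - a))) from
    (hmle p hp).trans (mul_le_mul_of_nonneg_right this (hpos p hp).le)
  rcases le_or_gt m 0 with hm0 | hm0
  · exact hm0.trans (by positivity)
  have hx₀ : ‖p₀.1 - x₀‖ ≤ ρ := by simpa [dist_eq_norm] using hp₀.1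
  have hta : 0 ≤ p₀.2 - a := by linarith [hp₀.2.1]
  have htb : p₀.2 - a ≤ b - a := by linarith [hp₀.2.2]
  have hr : ‖p₀.1 - x₀‖ ^ 2 ≤ ρ ^ 2 := by gcongr
  have hη0 : 0 < cutoff x₀ ρ a p₀ := by
    refine lt_of_le_of_ne (mul_nonneg (sq_nonneg _) hta) fun h0 => ?_
    rw [hm, ← h0] at hm0
    simp at hm0
  have hz : ‖p₀.1 - x₀‖ ≠ ρ := by
    intro h
    simp [cutoff, h] at hη0
  have hball : p₀.1 ∈ ball x₀ ρ := by
    simpa [dist_eq_norm] using lt_of_le_of_ne hx₀ hz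
  have hG0 : cutoff x₀ ρ a p₀ * gradSq spaceDir u p₀ - m * u p₀ = 0 := by rw [hmul, sub_self]
  have key := le_of_max_point (e := spaceDir) (τ := timeDir n) (m := m) (A := 16 * ρ ^ 2 * (b - a))
    (B := ρ ^ 4 + 4 * n * ρ ^ 2 * (b - a)) hU hu hη heat (hKU hp₀) (hpos p₀ hp₀) hη0 hm0 hmul
    ?_ ?_ ?_ ?_
  · refine key.trans ?_
    have := hle p₀ hp₀
    calc 4 * u p₀ * (5 / 2 * (16 * ρ ^ 2 * (b - a)) + (ρ ^ 4 + 4 * n * ρ ^ 2 * (b - a)))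
        ≤ 4 * M * (5 / 2 * (16 * ρ ^ 2 * (b - a)) + (ρ ^ 4 + 4 * n * ρ ^ 2 * (b - a))) := by gcongr
      _ = _ := by ring
  · intro i
    have hc : ContinuousAt (fun s : ℝ => p₀.1 + s • EuclideanSpace.single i (1 : ℝ)) 0 := by
      fun_prop
    have hmem := hc.eventually_mem (s := ball x₀ ρ) (by simpa using isOpen_ball.mem_nhds hball)
    filter_upwards [hmem] with s hs
    have hsK : p₀ + s • spaceDir i ∈ K :=
      ⟨ball_subset_closedBall (by simpa [spaceDir] using hs), by simpa [spaceDir] using hp₀.2⟩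
    simpa [hG0] using hmle _ hsK
  · have hG : DifferentiableAt ℝ (fun q => cutoff x₀ ρ a q * gradSq spaceDir u q - m * u q) p₀ :=
      ((hη.mul hP).sub (contDiffOn_const.mul hu)).differentiableAt_of_isOpen hU (hKU hp₀)
    have hloc : IsLocalMaxOn (fun q => cutoff x₀ ρ a q * gradSq spaceDir u q - m * u q) K p₀ :=
      IsMaxOn.localize fun q hq => by simpa [hG0] using hmle q hq
    have hbot : (p₀.1, a) ∈ K := ⟨hp₀.1, left_mem_Icc.2 hab⟩
    have hcone : -((p₀.2 - a) • timeDir n) ∈ posTangentConeAt K p₀ := by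
      refine mem_posTangentConeAt_of_segment_subset ?_
      have : p₀ + -((p₀.2 - a) • timeDir n) = (p₀.1, a) := by
        ext <;> simp [timeDir]
      rw [this]
      exact ((convex_closedBall x₀ ρ).prod (convex_Icc a b)).segment_subset hp₀ hbot
    have := hloc.hasFDerivWithinAt_nonpos hG.hasFDerivAt.hasFDerivWithinAt hcone
    rw [map_neg, map_smul, smul_eq_mul, neg_nonpos] at this
    have hpos' : 0 < p₀.2 - a := pos_of_mul_pos_right hη0 (sq_nonneg _)
    exact nonneg_of_mul_nonneg_right this hpos'
  · rw [gradSq_cutoff]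
    gcongr
  · rw [heat_cutoff]
    have h1 : 0 ≤ ρ ^ 2 - ‖p₀.1 - x₀‖ ^ 2 := by linarith
    have h2 : ρ ^ 2 - ‖p₀.1 - x₀‖ ^ 2 ≤ ρ ^ 2 := by linarith [sq_nonneg ‖p₀.1 - x₀‖]
    have h3 : (ρ ^ 2 - ‖p₀.1 - x₀‖ ^ 2) ^ 2 ≤ (ρ ^ 2) ^ 2 := by gcongr
    have h4 : (p₀.2 - a) * (4 * n * (ρ ^ 2 - ‖p₀.1 - x₀‖ ^ 2) - 8 * ‖p₀.1 - x₀‖ ^ 2) ≤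
        (b - a) * (4 * n * ρ ^ 2) := by
      refine (mul_le_mul_of_nonneg_left (b := _) (c := 4 * n * ρ ^ 2) ?_ hta).trans
        (mul_le_mul_of_nonneg_right htb (by positivity))
      have : 4 * n * (ρ ^ 2 - ‖p₀.1 - x₀‖ ^ 2) ≤ 4 * n * ρ ^ 2 := by gcongr
      linarith [sq_nonneg ‖p₀.1 - x₀‖]
    linarith

end InteriorEstimate
section HeatEquation

variable {n : ℕ} {u : EuclideanSpace ℝ (Fin n) × ℝ → ℝ} {p : EuclideanSpace ℝ (Fin n) × ℝ}

lemma fderiv_slice_single (hu : DifferentiableAt ℝ u p) (i : Fin n) :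
    fderiv ℝ (fun y => u (y, p.2)) p.1 (EuclideanSpace.single i 1) =
      dirDeriv (spaceDir i) u p := by
  have h : HasFDerivAt (fun y => u (y, p.2)) _ p.1 :=
    hu.hasFDerivAt.comp p.1 (hasFDerivAt_prodMk_left p.1 p.2)
  rw [h.fderiv]
  simp [dirDeriv, spaceDir]

lemma deriv_slice_time (hu : DifferentiableAt ℝ u p) :
    deriv (fun s => u (p.1, s)) p.2 = dirDeriv (timeDir n) u p := by
  have h : HasFDerivAt (fun s => u (p.1, s)) _ p.2 :=
    hu.hasFDerivAt.comp p.2 (hasFDerivAt_prodMk_right p.1 p.2)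
  rw [h.hasDerivAt.deriv]
  simp [dirDeriv, timeDir]

lemma lap_slice {U : Set (EuclideanSpace ℝ (Fin n) × ℝ)} (hU : IsOpen U)
    (hu : ContDiffOn ℝ ∞ u U) (hp : p ∈ U) :
    lap (fun y => u (y, p.2)) p.1 = ∑ i, dirDeriv (spaceDir i) (dirDeriv (spaceDir i) u) p := by
  refine Finset.sum_congr rfl fun i _ => ?_
  have hev : (fun y => fderiv ℝ (fun y => u (y, p.2)) y (EuclideanSpace.single i 1)) =ᶠ[𝓝 p.1]
      fun y => dirDeriv (spaceDir i) u (y, p.2) := by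
    have hc : ContinuousAt (fun y : EuclideanSpace ℝ (Fin n) => (y, p.2)) p.1 := by fun_prop
    filter_upwards [hc.eventually_mem (hU.mem_nhds hp)] with y hy
    exact fderiv_slice_single (p := (y, p.2)) (hu.differentiableAt_of_isOpen hU hy) i
  rw [hev.fderiv_eq]
  exact fderiv_slice_single ((hu.dirDeriv _ hU).differentiableAt_of_isOpen hU hp) i

lemma norm_gradient_sq {f : EuclideanSpace ℝ (Fin n) → ℝ} {x : EuclideanSpace ℝ (Fin n)} :
    ‖gradient f x‖ ^ 2 = ∑ i, fderiv ℝ f x (EuclideanSpace.single i 1) ^ 2 := by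
  rw [EuclideanSpace.real_norm_sq_eq]
  refine Finset.sum_congr rfl fun i _ => ?_
  rw [← inner_gradient_left, EuclideanSpace.inner_single_right]
  simp

/-- On a cylinder, the spatial gradient is given by the derivative within the cylinder, also at
the initial and final times. -/
lemma norm_gradient_slice_sq {x₀ : EuclideanSpace ℝ (Fin n)} {R : ℝ} {I : Set ℝ}
    (hu : DifferentiableOn ℝ u (closedBall x₀ R ×ˢ I)) (hx : p.1 ∈ ball x₀ R) (ht : p.2 ∈ I) :
    ‖gradient (fun y => u (y, p.2)) p.1‖ ^ 2 =
      ∑ i, fderivWithin ℝ u (closedBall x₀ R ×ˢ I) p (spaceDir i) ^ 2 := by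
  have hp : p ∈ closedBall x₀ R ×ˢ I := ⟨ball_subset_closedBall hx, ht⟩
  have h : HasFDerivAt (fun y => u (y, p.2)) _ p.1 :=
    (hu p hp).hasFDerivWithinAt.comp_hasFDerivAt p.1 (hasFDerivAt_prodMk_left p.1 p.2) (by
      filter_upwards [isOpen_ball.mem_nhds hx] with y hy using ⟨ball_subset_closedBall hy, ht⟩)
  rw [norm_gradient_sq, h.fderiv]
  simp [spaceDir]

end HeatEquation

/-- The gradient estimate away from the final time, in terms of the space-time derivative. -/
lemma gradSq_le_of_heat {n : ℕ} {M : ℝ} (hM : 0 < M) {x₀ : EuclideanSpace ℝ (Fin n)} {R T t₀ : ℝ}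
    (hR : 0 < R) (hT : 0 < T) {u : EuclideanSpace ℝ (Fin n) × ℝ → ℝ}
    (hu : ContDiffOn ℝ ∞ u (ball x₀ R ×ˢ Ioo (t₀ - T) t₀))
    (heat : ∀ q ∈ ball x₀ R ×ˢ Ioo (t₀ - T) t₀, dirDeriv (timeDir n) u q =
      ∑ i, dirDeriv (spaceDir i) (dirDeriv (spaceDir i) u) q)
    (hpos : ∀ q ∈ ball x₀ R ×ˢ Ioo (t₀ - T) t₀, 0 < u q)
    (hle : ∀ q ∈ ball x₀ R ×ˢ Ioo (t₀ - T) t₀, u q ≤ M)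
    {p : EuclideanSpace ℝ (Fin n) × ℝ} (hp : p ∈ closedBall x₀ (R / 2) ×ˢ Ico (t₀ - T / 2) t₀) :
    gradSq spaceDir u p ≤ 300 * M * (n + 10) * (1 / R ^ 2 + 1 / T) * u p := by
  have hKU : closedBall x₀ (3 * R / 4) ×ˢ Icc (t₀ - 3 * T / 4) p.2 ⊆
      ball x₀ R ×ˢ Ioo (t₀ - T) t₀ :=
    prod_mono (closedBall_subset_ball (by linarith))
      fun s hs => ⟨by linarith [hs.1], hs.2.trans_lt hp.2.2⟩
  have hab : t₀ - 3 * T / 4 ≤ p.2 := by linarith [hp.2.1]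
  have hpK : p ∈ closedBall x₀ (3 * R / 4) ×ˢ Icc (t₀ - 3 * T / 4) p.2 :=
    ⟨closedBall_subset_closedBall (by linarith) hp.1, hab, le_rfl⟩
  have key := cutoff_mul_gradSq_le hM (by positivity) hab (isOpen_ball.prod isOpen_Ioo) hKU hu heat
    (fun q hq => hpos q (hKU hq)) (fun q hq => hle q (hKU hq)) hpK
  have hup := hpos p (hKU hpK)
  have hW : 0 ≤ gradSq spaceDir u p := Finset.sum_nonneg fun i _ => sq_nonneg _
  have hlow : (5 * R ^ 2 / 16) ^ 2 * (T / 4) ≤ cutoff x₀ (3 * R / 4) (t₀ - 3 * T / 4) p := by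
    have hx : ‖p.1 - x₀‖ ≤ R / 2 := by simpa [dist_eq_norm] using hp.1
    have hx2 : ‖p.1 - x₀‖ ^ 2 ≤ (R / 2) ^ 2 := by gcongr
    unfold cutoff
    gcongr
    · nlinarith
    · linarith [hp.2.1]
  have hba : p.2 - (t₀ - 3 * T / 4) ≤ 3 * T / 4 := by linarith [hp.2.2]
  have hmain : (5 * R ^ 2 / 16) ^ 2 * (T / 4) * gradSq spaceDir u p ≤
      4 * M * (40 * (3 * R / 4) ^ 2 * (3 * T / 4) +
        ((3 * R / 4) ^ 4 + 4 * n * (3 * R / 4) ^ 2 * (3 * T / 4))) * u p :=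
    (mul_le_mul_of_nonneg_right hlow hW).trans (key.trans (by gcongr))
  have hc : 0 < (5 * R ^ 2 / 16) ^ 2 * (T / 4) := by positivity
  refine le_of_mul_le_mul_left (hmain.trans ?_) hc
  have hexp : (5 * R ^ 2 / 16) ^ 2 * (T / 4) *
      (300 * M * (n + 10) * (1 / R ^ 2 + 1 / T) * u p) =
      (5 / 16) ^ 2 * 75 * M * (n + 10) * (R ^ 2 * T + R ^ 4) * u p := by
    field_simp
    ring
  rw [hexp]
  have hMu : 0 ≤ M * u p := by positivity
  have hpoly : 4 * (40 * (3 * R / 4) ^ 2 * (3 * T / 4) +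
        ((3 * R / 4) ^ 4 + 4 * n * (3 * R / 4) ^ 2 * (3 * T / 4))) ≤
      (5 / 16) ^ 2 * 75 * (n + 10) * (R ^ 2 * T + R ^ 4) := by
    have h1 : 0 ≤ R ^ 2 * T := by positivity
    have h2 : 0 ≤ R ^ 4 := by positivity
    have h3 : 0 ≤ n * (R ^ 2 * T) := by positivity
    have h4 : 0 ≤ n * R ^ 4 := by positivity
    linarith
  linarith [mul_le_mul_of_nonneg_left hpoly hMu]

/-- Corollary 1.2 (Euclidean case, `k = 0`): there is a constant `C = C(n, M) > 0` such that
every smooth positive solution of the heat equation `u_t = Δu` on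
`Q_{R,T} = B(x₀,R) × [t₀−T, t₀]` with `u ≤ M` satisfies
`|∇u|/√u ≤ C (1/R + 1/√T)` on `Q_{R/2,T/2}`. -/
theorem gradient_estimate_heat (n : ℕ) (hn : 1 ≤ n) (M : ℝ) (hM : 0 < M) :
    ∃ C > (0 : ℝ), ∀ (x₀ : EuclideanSpace ℝ (Fin n)) (R T t₀ : ℝ),
      0 < R → 0 < T →
      ∀ u : EuclideanSpace ℝ (Fin n) × ℝ → ℝ,
        ContDiffOn ℝ (⊤ : ℕ∞) u (closedBall x₀ R ×ˢ Icc (t₀ - T) t₀) →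
        (∀ p ∈ closedBall x₀ R ×ˢ Icc (t₀ - T) t₀, 0 < u p) →
        (∀ p ∈ closedBall x₀ R ×ˢ Icc (t₀ - T) t₀,
          deriv (fun s => u (p.1, s)) p.2 = lap (fun y => u (y, p.2)) p.1) →
        (∀ p ∈ closedBall x₀ R ×ˢ Icc (t₀ - T) t₀, u p ≤ M) →
        ∀ p ∈ closedBall x₀ (R / 2) ×ˢ Icc (t₀ - T / 2) t₀,
          ‖gradient (fun y => u (y, p.2)) p.1‖ / Real.sqrt (u p) ≤
            C * (1 / R + 1 / Real.sqrt T) := by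
  refine ⟨√(300 * M * (n + 10)), by positivity, ?_⟩
  intro x₀ R T t₀ hR hT u hu hpos heat hle p hp
  set Q := closedBall x₀ R ×ˢ Icc (t₀ - T) t₀ with hQ
  set U := ball x₀ R ×ˢ Ioo (t₀ - T) t₀ with hUdef
  have hU : IsOpen U := isOpen_ball.prod isOpen_Ioo
  have hUQ : U ⊆ Q := prod_mono ball_subset_closedBall Ioo_subset_Icc_self
  have huU : ContDiffOn ℝ ∞ u U := hu.mono hUQ
  have hQuniq : UniqueDiffOn ℝ Q := by
    refine uniqueDiffOn_convex ((convex_closedBall x₀ R).prod (convex_Icc _ _)) ?_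
    exact ⟨(x₀, t₀ - T / 2), interior_maximal hUQ hU
      ⟨mem_ball_self hR, by linarith, by linarith⟩⟩
  have heatU : ∀ q ∈ U, dirDeriv (timeDir n) u q =
      ∑ i, dirDeriv (spaceDir i) (dirDeriv (spaceDir i) u) q := fun q hq => by
    rw [← deriv_slice_time (huU.differentiableAt_of_isOpen hU hq), heat q (hUQ hq),
      lap_slice hU huU hq]
  have hinner : closedBall x₀ (R / 2) ×ˢ Icc (t₀ - T / 2) t₀ ⊆ Q :=
    prod_mono (closedBall_subset_closedBall (by linarith)) (Icc_subset_Icc_left (by linarith))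
  set W : EuclideanSpace ℝ (Fin n) × ℝ → ℝ := fun q => ∑ i, fderivWithin ℝ u Q q (spaceDir i) ^ 2
  have hWcont : ContinuousOn W Q := continuousOn_finsetSum _ fun i _ =>
    ((hu.continuousOn_fderivWithin hQuniq (by simp)).clm_apply continuousOn_const).pow 2
  have hW : W p ≤ 300 * M * (n + 10) * (1 / R ^ 2 + 1 / T) * u p := by
    have hcl : closure (closedBall x₀ (R / 2) ×ˢ Ico (t₀ - T / 2) t₀) =
        closedBall x₀ (R / 2) ×ˢ Icc (t₀ - T / 2) t₀ := by
      rw [closure_prod_eq, isClosed_closedBall.closure_eq, closure_Ico (by linarith)]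
    refine le_on_closure (s := closedBall x₀ (R / 2) ×ˢ Ico (t₀ - T / 2) t₀) (fun q hq => ?_)
      (hcl ▸ hWcont.mono hinner)
      (hcl ▸ continuousOn_const.mul (hu.continuousOn.mono hinner)) (hcl ▸ hp)
    have hqU : q ∈ U := ⟨closedBall_subset_ball (by linarith) hq.1, by linarith [hq.2.1], hq.2.2⟩
    have hWq : W q = gradSq spaceDir u q := by
      simp only [W, gradSq, dirDeriv,
        fderivWithin_of_mem_nhds (mem_of_superset (hU.mem_nhds hqU) hUQ)]
    rw [hWq]
    exact gradSq_le_of_heat hM hR hT huU heatU (fun q hq => hpos q (hUQ hq))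
      (fun q hq => hle q (hUQ hq)) hq
  have hup := hpos p (hinner hp)
  have hgrad : ‖gradient (fun y => u (y, p.2)) p.1‖ ^ 2 = W p :=
    norm_gradient_slice_sq (hu.differentiableOn (by simp))
      (closedBall_subset_ball (by linarith) hp.1) (hinner hp).2
  have hsum : 1 / R ^ 2 + 1 / T ≤ (1 / R + 1 / √T) ^ 2 := by
    have h1 : (1 / √T) ^ 2 = 1 / T := by rw [div_pow, Real.sq_sqrt hT.le, one_pow]
    have h2 : 0 ≤ 1 / R * (1 / √T) := by positivity
    have h3 : (1 / R) ^ 2 = 1 / R ^ 2 := by rw [div_pow, one_pow]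
    nlinarith
  rw [div_le_iff₀ (Real.sqrt_pos.2 hup)]
  refine (pow_le_pow_iff_left₀ (norm_nonneg _) (by positivity) two_ne_zero).1 ?_
  rw [hgrad, mul_pow, mul_pow, Real.sq_sqrt hup.le, Real.sq_sqrt (by positivity)]
  exact hW.trans (by gcongr)
end
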